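/- arXiv:2004.08732 — 14 statements merged into one kernel-verified Lean document; each statement's English description precedes it below -/
import Mathlib

section
/- Let Γ be an oriented graph or a 2-edge-coloured graph, let H be a reflexive target (a reflexive oriented graph, respectively a reflexive 2-edge-coloured graph), and let φ be a homomorphism of Γ to H. If uv is an arc (respectively an edge) of Γ with φ(u) = φ(v), then φ(x) = φ(u) for every vertex x in conv({u,v}). (Oriented case.) -/
/-- `v` is the centre of a 2-dipath `u, v, w` in the oriented graph with arc
relation `A`: arcs `uv`, `vw` with `u ≠ v` and `v ≠ w`. -/
def TwoDipathCentre {V : Type} (A : V → V → Prop) (v u w : V) : Prop :=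
  u ≠ v ∧ v ≠ w ∧ A u v ∧ A v w

/-- A set `S` of vertices is convex when no vertex outside `S` is the centre of
a 2-dipath both of whose ends lie in `S`. -/
def OrientConvex {V : Type} (A : V → V → Prop) (S : Set V) : Prop :=
  ∀ v u w, u ∈ S → w ∈ S → TwoDipathCentre A v u w → v ∈ S

/-- The convex hull of `S`: the smallest convex set containing `S`. -/
def orientConvHull {V : Type} (A : V → V → Prop) (S : Set V) : Set V :=
  ⋂₀ {T : Set V | S ⊆ T ∧ OrientConvex A T}

/-- An oriented graph is complete convex when the convex hull of (the ends of)
each arc is the whole vertex set. -/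
def OrientCompleteConvex {V : Type} (A : V → V → Prop) : Prop :=
  ∀ u v, A u v → orientConvHull A {u, v} = Set.univ

/-- if a homomorphism of an oriented graph to a reflexive oriented
graph identifies the two ends of an arc `uv`, then it is constant on the convex
hull of `{u, v}`. -/
theorem oriented_constant_on_convex_hull
    {V : Type} [Fintype V] (A : V → V → Prop)
    (hirr : Irreflexive A) (hanti : ∀ u v, A u v → ¬ A v u)
    (W : Type) (hWfin : Finite W) (B : W → W → Prop)
    (hrefl : Reflexive B) (hone : ∀ x y : W, x ≠ y → B x y → ¬ B y x)
    (φ : V → W) (hhom : ∀ u v, A u v → B (φ u) (φ v))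
    (u v : V) (huv : A u v) (heq : φ u = φ v) :
    ∀ x ∈ orientConvHull A {u, v}, φ x = φ u := by
  refine Set.sInter_subset_of_mem (t := {x | φ x = φ u}) ⟨?_, ?_⟩
  · rintro x (rfl | rfl)
    · rfl
    · exact heq.symm
  · rintro x a b (ha : φ a = φ u) (hb : φ b = φ u) ⟨-, -, hax, hxb⟩
    have hux := hhom a x hax
    have hxu := hhom x b hxb
    rw [ha] at hux
    rw [hb] at hxu
    by_contra hne
    exact hone _ _ hne hxu hux
end

section
/- Let (G, c_G) be a 2-edge-coloured graph, let (H, c_H) be a reflexive 2-edge-coloured graph, and let φ be a homomorphism of (G, c_G) to (H, c_H). If uv is an edge of G with φ(u) = φ(v), then φ(x) = φ(u) for every vertex x in conv({u,v}). -/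
/-- In the 2-edge-coloured graph with red edges `R` and blue edges `B`, `v` is
the centre of an alternating 2-path `u, v, w`: edges `uv`, `vw` of different
colours with `u ≠ v` and `v ≠ w`. -/
def AltCentre {V : Type} (R B : SimpleGraph V) (v u w : V) : Prop :=
  u ≠ v ∧ v ≠ w ∧ ((R.Adj u v ∧ B.Adj v w) ∨ (B.Adj u v ∧ R.Adj v w))

/-- A set `S` of vertices is convex when no vertex outside `S` is the centre of
an alternating 2-path both of whose ends lie in `S`. -/
def TwoECConvex {V : Type} (R B : SimpleGraph V) (S : Set V) : Prop :=
  ∀ v u w, u ∈ S → w ∈ S → AltCentre R B v u w → v ∈ S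

/-- The convex hull of `S`: the smallest convex set containing `S`. -/
def twoECConvHull {V : Type} (R B : SimpleGraph V) (S : Set V) : Set V :=
  ⋂₀ {T : Set V | S ⊆ T ∧ TwoECConvex R B T}

/-- A 2-edge-coloured graph is complete convex when the convex hull of (the
ends of) each edge is the whole vertex set. -/
def TwoECCompleteConvex {V : Type} (R B : SimpleGraph V) : Prop :=
  ∀ u v, (R ⊔ B).Adj u v → twoECConvHull R B {u, v} = Set.univ

/-- The fibres of a homomorphism to a 2-edge-coloured graph are convex. -/
theorem twoECConvex_fibre {V W : Type} {R B : SimpleGraph V} {R' B' : W → W → Prop}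
    (hR'symm : Symmetric R') (hB'symm : Symmetric B')
    (hone : ∀ x y : W, x ≠ y → ¬(R' x y ∧ B' x y)) {φ : V → W}
    (hhomR : ∀ u v, R.Adj u v → R' (φ u) (φ v))
    (hhomB : ∀ u v, B.Adj u v → B' (φ u) (φ v)) (a : W) :
    TwoECConvex R B {x | φ x = a} := by
  rintro x y z rfl hz ⟨-, -, h⟩
  have hz : φ z = φ y := hz
  by_contra hne
  rcases h with ⟨hyx, hxz⟩ | ⟨hyx, hxz⟩
  · exact hone _ _ hne ⟨hR'symm (hhomR _ _ hyx), hz ▸ hhomB _ _ hxz⟩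
  · exact hone _ _ hne ⟨hz ▸ hhomR _ _ hxz, hB'symm (hhomB _ _ hyx)⟩

/-- if a homomorphism of a 2-edge-coloured graph (red edges `R`,
blue edges `B`) to a reflexive 2-edge-coloured graph identifies the two ends of
an edge `uv`, then it is constant on the convex hull of `{u, v}`. -/
theorem twoec_constant_on_convex_hull
    {V : Type} [Fintype V] (R B : SimpleGraph V)
    (hdisj : ∀ u v, ¬(R.Adj u v ∧ B.Adj u v))
    (W : Type) (hWfin : Finite W) (R' B' : W → W → Prop)
    (hR'symm : Symmetric R') (hB'symm : Symmetric B')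
    (hR'refl : Reflexive R') (hB'refl : Reflexive B')
    (hone : ∀ x y : W, x ≠ y → ¬(R' x y ∧ B' x y))
    (φ : V → W)
    (hhomR : ∀ u v, R.Adj u v → R' (φ u) (φ v))
    (hhomB : ∀ u v, B.Adj u v → B' (φ u) (φ v))
    (u v : V) (huv : (R ⊔ B).Adj u v) (heq : φ u = φ v) :
    ∀ x ∈ twoECConvHull R B {u, v}, φ x = φ u := by
  intro x hx
  refine hx {y | φ y = φ u}
    ⟨?_, twoECConvex_fibre hR'symm hB'symm hone hhomR hhomB (φ u)⟩
  rintro y (rfl | rfl)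
  exacts [rfl, heq.symm]
end

section
/- An oriented graph G⃗ admits no improper homomorphism (i.e., every homomorphism of G⃗ to any reflexive oriented graph is either trivial or proper) if and only if G⃗ is complete convex. -/
theorem orientConvHull_subset {V : Type} {A : V → V → Prop} {S T : Set V}
    (hST : S ⊆ T) (hT : OrientConvex A T) : orientConvHull A S ⊆ T :=
  Set.sInter_subset_of_mem ⟨hST, hT⟩

theorem subset_orientConvHull {V : Type} (A : V → V → Prop) (S : Set V) :
    S ⊆ orientConvHull A S :=
  Set.subset_sInter fun _ hT => hT.1

theorem orientConvex_orientConvHull {V : Type} (A : V → V → Prop) (S : Set V) :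
    OrientConvex A (orientConvHull A S) :=
  fun v u w hu hw h T hT => hT.2 v u w (hu T hT) (hw T hT) h

/-- The fibres of a homomorphism to a reflexive oriented graph are convex. -/
theorem orientConvex_fiber {V W : Type} {A : V → V → Prop} {B : W → W → Prop}
    (hB : ∀ x y : W, x ≠ y → B x y → ¬ B y x) {φ : V → W}
    (hφ : ∀ u v, A u v → B (φ u) (φ v)) (c : W) : OrientConvex A {x | φ x = c} := by
  intro v u w hu hw h
  have hu : φ u = c := hu
  have hw : φ w = c := hw
  have h₁ := hφ u v h.2.2.1
  have h₂ := hφ v w h.2.2.2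
  rw [hu] at h₁
  rw [hw] at h₂
  by_contra hne
  exact hB (φ v) c hne h₂ h₁

open Classical in
/-- The map contracting `S` to the single point `none`. -/
noncomputable def contractSet {V : Type} (S : Set V) (x : V) : Option V :=
  if x ∈ S then none else some x

theorem contractSet_eq_none {V : Type} {S : Set V} {x : V} :
    contractSet S x = none ↔ x ∈ S := by
  simp [contractSet]

theorem contractSet_eq_contractSet {V : Type} {S : Set V} {x y : V} :
    contractSet S x = contractSet S y ↔ x = y ∨ x ∈ S ∧ y ∈ S := by
  unfold contractSet
  split_ifs <;> grind

/-- The reflexive digraph obtained from `A` by contracting `S`. -/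
def contractArc {V : Type} (A : V → V → Prop) (S : Set V) (x y : Option V) : Prop :=
  x = y ∨ ∃ a b, A a b ∧ contractSet S a = x ∧ contractSet S b = y

/-- Contracting a convex set of an oriented graph leaves a reflexive oriented graph. -/
theorem contractArc_antisymm {V : Type} {A : V → V → Prop} {S : Set V}
    (hanti : ∀ u v, A u v → ¬ A v u) (hS : OrientConvex A S) (x y : Option V)
    (hxy : x ≠ y) (h : contractArc A S x y) : ¬ contractArc A S y x := by
  rintro (h' | ⟨c, d, hcd, rfl, rfl⟩)
  · exact hxy h'.symm
  rcases h with h | ⟨a, b, hab, had, hbc⟩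
  · exact hxy h
  rw [Ne, contractSet_eq_contractSet] at hxy
  rw [contractSet_eq_contractSet] at had hbc
  rcases had with rfl | ⟨ha, hd⟩ <;> rcases hbc with rfl | ⟨hb, hc⟩
  · exact hanti _ _ hab hcd
  · exact hxy (.inr ⟨hS a c b hc hb ⟨by grind, by grind, hcd, hab⟩, hc⟩)
  · exact hxy (.inr ⟨hd, hS b a d ha hd ⟨by grind, by grind, hab, hcd⟩⟩)
  · exact hxy (.inr ⟨hd, hc⟩)

/-- an oriented graph admits no improper homomorphism (every
homomorphism to any reflexive oriented graph is trivial or proper) if and only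
if it is complete convex. -/
theorem oriented_no_improper_iff_complete_convex
    {V : Type} [Fintype V] (A : V → V → Prop)
    (hirr : Irreflexive A) (hanti : ∀ u v, A u v → ¬ A v u) :
    (∀ (W : Type), Finite W → ∀ B : W → W → Prop,
      Reflexive B → (∀ x y : W, x ≠ y → B x y → ¬ B y x) →
      ∀ φ : V → W, (∀ u v, A u v → B (φ u) (φ v)) →
        (∃ w, ∀ x, φ x = w) ∨ (∀ u v, A u v → φ u ≠ φ v))
    ↔ OrientCompleteConvex A := by
  constructor
  · intro h u v huv
    set S := orientConvHull A {u, v} with hSdef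
    have hsub : {u, v} ⊆ S := subset_orientConvHull A _
    have hu : u ∈ S := hsub (by simp)
    have hv : v ∈ S := hsub (by simp)
    rcases h (Option V) inferInstance (contractArc A S) (fun _ => .inl rfl)
      (contractArc_antisymm hanti (orientConvex_orientConvHull A _)) (contractSet S)
      (fun a b hab => .inr ⟨a, b, hab, rfl, rfl⟩) with ⟨w, hw⟩ | hproper
    · refine Set.eq_univ_of_forall fun x => contractSet_eq_none.1 ?_
      rw [hw x, ← hw u, contractSet_eq_none]
      exact hu
    · exact absurd (contractSet_eq_contractSet.2 (.inr ⟨hu, hv⟩)) (hproper u v huv)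
  · intro h W _ B _ hB φ hφ
    by_contra! hcon
    obtain ⟨hnontrivial, u, v, huv, heq⟩ := hcon
    obtain ⟨x, hx⟩ := hnontrivial (φ u)
    have hsub : orientConvHull A {u, v} ⊆ {x | φ x = φ u} :=
      orientConvHull_subset (by rintro y (rfl | rfl) <;> simp [heq])
        (orientConvex_fiber hB hφ _)
    exact hx (hsub (h u v huv ▸ Set.mem_univ x))
end

section
/- Let G⃗ and H⃗ be oriented graphs with disjoint vertex sets. If G⃗ and H⃗ are each complete convex, then any oriented graph formed by identifying an arc of G⃗ with an arc of H⃗ (identifying the tail of one arc with the tail of the other and the head with the head, and leaving all remaining vertices and arcs unchanged) is complete convex. -/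
/-- The preimage of a convex set under an injective arc-preserving map is convex. -/
theorem OrientConvex.preimage {V U : Type} {A : V → V → Prop} {J : U → U → Prop} {f : V → U}
    (hf : Function.Injective f) (hAJ : ∀ a a', A a a' → J (f a) (f a')) {T : Set U}
    (hT : OrientConvex J T) : OrientConvex A (f ⁻¹' T) := by
  rintro v u w hu hw ⟨huv, hvw, h₁, h₂⟩
  exact hT _ _ _ hu hw ⟨hf.ne huv, hf.ne hvw, hAJ _ _ h₁, hAJ _ _ h₂⟩

/-- A convex set containing both ends of an arc of an embedded complete convex oriented graph
contains every vertex of that graph. -/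
theorem OrientCompleteConvex.mem_of_arc {V U : Type} {A : V → V → Prop} {J : U → U → Prop}
    (hA : OrientCompleteConvex A) {f : V → U} (hf : Function.Injective f)
    (hAJ : ∀ a a', A a a' → J (f a) (f a')) {T : Set U} (hT : OrientConvex J T) {a a' : V}
    (haa' : A a a') (ha : f a ∈ T) (ha' : f a' ∈ T) (x : V) : f x ∈ T := by
  have hx : x ∈ orientConvHull A {a, a'} := by
    rw [hA a a' haa']
    trivial
  exact hx (f ⁻¹' T) ⟨Set.pair_subset ha ha', hT.preimage hf hAJ⟩

/-- identifying an arc of a complete-convex oriented graph `A` (on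
vertices `V`) with an arc of a complete-convex oriented graph `B` (on the
disjoint vertex set `W`) -- tail with tail and head with head -- yields a
complete-convex oriented graph `J`. -/
theorem glue_arc_complete_convex
    {V W U : Type} [Fintype V] [Fintype W] [Fintype U]
    (A : V → V → Prop) (B : W → W → Prop)
    (hAirr : Irreflexive A) (hAanti : ∀ u v, A u v → ¬ A v u)
    (hBirr : Irreflexive B) (hBanti : ∀ u v, B u v → ¬ B v u)
    (hAcc : OrientCompleteConvex A) (hBcc : OrientCompleteConvex B)
    (g₁ g₂ : V) (h₁ h₂ : W) (hg : A g₁ g₂) (hh : B h₁ h₂)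
    (i : V → U) (j : W → U)
    (hi : Function.Injective i) (hj : Function.Injective j)
    (hcover : ∀ u : U, (∃ a, i a = u) ∨ (∃ b, j b = u))
    (hglue1 : i g₁ = j h₁) (hglue2 : i g₂ = j h₂)
    (hmeet : ∀ a b, i a = j b → (a = g₁ ∧ b = h₁) ∨ (a = g₂ ∧ b = h₂))
    (J : U → U → Prop)
    (hJ : ∀ u u', J u u' ↔
      (∃ a a', A a a' ∧ i a = u ∧ i a' = u') ∨
      (∃ b b', B b b' ∧ j b = u ∧ j b' = u')) :
    OrientCompleteConvex J := by
  have hAJ : ∀ a a', A a a' → J (i a) (i a') := fun a a' h =>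
    (hJ _ _).2 (Or.inl ⟨a, a', h, rfl, rfl⟩)
  have hBJ : ∀ b b', B b b' → J (j b) (j b') := fun b b' h =>
    (hJ _ _).2 (Or.inr ⟨b, b', h, rfl, rfl⟩)
  intro u u' huu'
  refine Set.eq_univ_of_forall fun x T ⟨hsub, hT⟩ => ?_
  have hu : u ∈ T := hsub (Or.inl rfl)
  have hu' : u' ∈ T := hsub (Or.inr rfl)
  have hall : (∀ a, i a ∈ T) ∧ ∀ b, j b ∈ T := by
    rcases (hJ u u').1 huu' with ⟨a, a', h, rfl, rfl⟩ | ⟨b, b', h, rfl, rfl⟩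
    · have hV := hAcc.mem_of_arc hi hAJ hT h hu hu'
      exact ⟨hV, hBcc.mem_of_arc hj hBJ hT hh (hglue1 ▸ hV g₁) (hglue2 ▸ hV g₂)⟩
    · have hW := hBcc.mem_of_arc hj hBJ hT h hu hu'
      exact ⟨hAcc.mem_of_arc hi hAJ hT hg (hglue1 ▸ hW h₁) (hglue2 ▸ hW h₂), hW⟩
  rcases hcover x with ⟨a, rfl⟩ | ⟨b, rfl⟩
  · exact hall.1 a
  · exact hall.2 b
end

section
/- Let (G, c_G) and (H, c_H) be 2-edge-coloured graphs with disjoint vertex sets. If (G, c_G) and (H, c_H) are each complete convex, then any 2-edge-coloured graph formed by identifying an edge of (G, c_G) with an edge of (H, c_H) of the same colour (a red edge with a red edge, or a blue edge with a blue edge, identifying one endpoint with one endpoint and the other with the other, leaving all remaining vertices and edges unchanged) is complete convex. -/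
theorem TwoECConvex.preimage {V U : Type} {R B : SimpleGraph V} {R' B' : SimpleGraph U}
    {T : Set U} (hT : TwoECConvex R' B' T) (f : V → U)
    (hR : ∀ a b, R.Adj a b → R'.Adj (f a) (f b))
    (hB : ∀ a b, B.Adj a b → B'.Adj (f a) (f b)) :
    TwoECConvex R B (f ⁻¹' T) := by
  rintro v u w hu hw ⟨-, -, ⟨h, h'⟩ | ⟨h, h'⟩⟩
  · exact hT _ _ _ hu hw ⟨(hR _ _ h).ne, (hB _ _ h').ne, .inl ⟨hR _ _ h, hB _ _ h'⟩⟩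
  · exact hT _ _ _ hu hw ⟨(hB _ _ h).ne, (hR _ _ h').ne, .inr ⟨hB _ _ h, hR _ _ h'⟩⟩

theorem TwoECCompleteConvex.mem_of_convex {V : Type} {R B : SimpleGraph V}
    (h : TwoECCompleteConvex R B) {T : Set V} (hT : TwoECConvex R B T) {u v : V}
    (huv : (R ⊔ B).Adj u v) (hu : u ∈ T) (hv : v ∈ T) (x : V) : x ∈ T := by
  have hx : x ∈ twoECConvHull R B {u, v} := h u v huv ▸ Set.mem_univ x
  exact hx T ⟨Set.pair_subset hu hv, hT⟩


/-- identifying an edge of a complete-convex 2-edge-coloured graph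
`(RG, BG)` with an edge of the same colour of a complete-convex 2-edge-coloured
graph `(RH, BH)` on a disjoint vertex set (endpoint with endpoint) yields a
complete-convex 2-edge-coloured graph `(RJ, BJ)`. -/
theorem glue_edge_complete_convex
    {V W U : Type} [Fintype V] [Fintype W] [Fintype U]
    (RG BG : SimpleGraph V) (RH BH : SimpleGraph W)
    (hdisjG : ∀ u v, ¬(RG.Adj u v ∧ BG.Adj u v))
    (hdisjH : ∀ u v, ¬(RH.Adj u v ∧ BH.Adj u v))
    (hccG : TwoECCompleteConvex RG BG) (hccH : TwoECCompleteConvex RH BH)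
    (g₁ g₂ : V) (h₁ h₂ : W)
    (hsame : (RG.Adj g₁ g₂ ∧ RH.Adj h₁ h₂) ∨ (BG.Adj g₁ g₂ ∧ BH.Adj h₁ h₂))
    (i : V → U) (j : W → U)
    (hi : Function.Injective i) (hj : Function.Injective j)
    (hcover : ∀ u : U, (∃ a, i a = u) ∨ (∃ b, j b = u))
    (hglue1 : i g₁ = j h₁) (hglue2 : i g₂ = j h₂)
    (hmeet : ∀ a b, i a = j b → (a = g₁ ∧ b = h₁) ∨ (a = g₂ ∧ b = h₂))
    (RJ BJ : SimpleGraph U)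
    (hRJ : ∀ u u', RJ.Adj u u' ↔
      (∃ a a', RG.Adj a a' ∧ i a = u ∧ i a' = u') ∨
      (∃ b b', RH.Adj b b' ∧ j b = u ∧ j b' = u'))
    (hBJ : ∀ u u', BJ.Adj u u' ↔
      (∃ a a', BG.Adj a a' ∧ i a = u ∧ i a' = u') ∨
      (∃ b b', BH.Adj b b' ∧ j b = u ∧ j b' = u')) :
    TwoECCompleteConvex RJ BJ := by
  have hGedge : (RG ⊔ BG).Adj g₁ g₂ := hsame.imp And.left And.left
  have hHedge : (RH ⊔ BH).Adj h₁ h₂ := hsame.imp And.right And.right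
  intro u u' huu'
  refine Set.eq_univ_of_forall fun x T ⟨hsub, hT⟩ => ?_
  have hu : u ∈ T := hsub (by simp)
  have hu' : u' ∈ T := hsub (by simp)
  have hTG : TwoECConvex RG BG (i ⁻¹' T) := hT.preimage i
    (fun a b h => (hRJ _ _).2 (.inl ⟨a, b, h, rfl, rfl⟩))
    (fun a b h => (hBJ _ _).2 (.inl ⟨a, b, h, rfl, rfl⟩))
  have hTH : TwoECConvex RH BH (j ⁻¹' T) := hT.preimage j
    (fun a b h => (hRJ _ _).2 (.inr ⟨a, b, h, rfl, rfl⟩))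
    (fun a b h => (hBJ _ _).2 (.inr ⟨a, b, h, rfl, rfl⟩))
  have hedge : (∃ a a', (RG ⊔ BG).Adj a a' ∧ i a = u ∧ i a' = u') ∨
      (∃ b b', (RH ⊔ BH).Adj b b' ∧ j b = u ∧ j b' = u') := by
    rcases huu' with h | h
    · exact ((hRJ _ _).1 h).imp (fun ⟨a, a', h, e⟩ => ⟨a, a', .inl h, e⟩)
        (fun ⟨b, b', h, e⟩ => ⟨b, b', .inl h, e⟩)
    · exact ((hBJ _ _).1 h).imp (fun ⟨a, a', h, e⟩ => ⟨a, a', .inr h, e⟩)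
        (fun ⟨b, b', h, e⟩ => ⟨b, b', .inr h, e⟩)
  have hall : (∀ a, i a ∈ T) ∧ ∀ b, j b ∈ T := by
    rcases hedge with ⟨a, a', h, rfl, rfl⟩ | ⟨b, b', h, rfl, rfl⟩
    · have hV : ∀ a, i a ∈ T := hccG.mem_of_convex hTG h hu hu'
      exact ⟨hV, hccH.mem_of_convex hTH hHedge (hglue1 ▸ hV g₁ : j h₁ ∈ T)
        (hglue2 ▸ hV g₂ : j h₂ ∈ T)⟩
    · have hW : ∀ b, j b ∈ T := hccH.mem_of_convex hTH h hu hu'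
      exact ⟨hccG.mem_of_convex hTG hGedge (hglue1 ▸ hW h₁ : i g₁ ∈ T)
        (hglue2 ▸ hW h₂ : i g₂ ∈ T), hW⟩
  rcases hcover x with ⟨a, rfl⟩ | ⟨b, rfl⟩
  · exact hall.1 a
  · exact hall.2 b
end

section
/- Let G be a graph and let v be a vertex of degree 2 in G. If G⃗ is a complete-convex orientation of G, then v is contained in a directed 3-cycle in G⃗ (that is, v together with its two neighbours induces a directed 3-cycle). -/
/-- A vertex outside the ends of an edge `v x`, where `v` has only one other neighbour `y`, is
reached by the convex hull of that edge only through a 2-dipath centred at `y`. -/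
theorem dipath_through_other_neighbour {V : Type} {G : SimpleGraph V} {A : V → V → Prop}
    (horient : ∀ u w, A u w ∨ A w u ↔ G.Adj u w) (hanti : ∀ u w, A u w → ¬ A w u)
    (hcc : OrientCompleteConvex A) {v x y : V} (hxy : x ≠ y)
    (hnbr : ∀ z, G.Adj v z ↔ z = x ∨ z = y) :
    (A v y ∧ A y x) ∨ (A x y ∧ A y v) := by
  have hvx : G.Adj v x := (hnbr x).2 (Or.inl rfl)
  have hvy : G.Adj v y := (hnbr y).2 (Or.inr rfl)
  have hull : orientConvHull A {v, x} = Set.univ := by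
    rcases (horient v x).2 hvx with h | h
    · exact hcc v x h
    · rw [Set.pair_comm]
      exact hcc x v h
  have hnot : ¬ OrientConvex A {v, x} := by
    intro hconv
    have hy : y ∈ orientConvHull A {v, x} := hull ▸ Set.mem_univ y
    rcases hy {v, x} ⟨subset_rfl, hconv⟩ with h | h
    · exact hvy.ne h.symm
    · exact hxy h.symm
  unfold OrientConvex at hnot
  push Not at hnot
  obtain ⟨z, a, b, ha, hb, ⟨-, -, haz, hzb⟩, hz⟩ := hnot
  have other : G.Adj v z → z = y := fun h =>
    ((hnbr z).1 h).resolve_left fun hzx => hz (Or.inr hzx)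
  rcases ha with rfl | rfl <;> rcases hb with rfl | rfl
  · exact absurd hzb (hanti _ _ haz)
  · obtain rfl := other ((horient _ _).1 (Or.inl haz))
    exact Or.inl ⟨haz, hzb⟩
  · obtain rfl := other ((horient _ _).1 (Or.inr hzb))
    exact Or.inr ⟨haz, hzb⟩
  · exact absurd hzb (hanti _ _ haz)

/-- if `v` has degree 2 in `G` and `A` is a complete-convex
orientation of `G`, then `v` together with its two neighbours induces a
directed 3-cycle. -/
theorem degree_two_in_directed_triangle
    {V : Type} [Fintype V] [DecidableEq V] (G : SimpleGraph V)
    [DecidableRel G.Adj]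
    (v : V) (hdeg : G.degree v = 2)
    (A : V → V → Prop)
    (horient : ∀ u w, A u w ∨ A w u ↔ G.Adj u w)
    (hanti : ∀ u w, A u w → ¬ A w u)
    (hcc : OrientCompleteConvex A) :
    ∃ x y : V, x ≠ y ∧ G.Adj v x ∧ G.Adj v y ∧
      ((A v x ∧ A x y ∧ A y v) ∨ (A v y ∧ A y x ∧ A x v)) := by
  obtain ⟨x, y, hxy, hN⟩ := Finset.card_eq_two.1 hdeg
  have hnbr : ∀ z, G.Adj v z ↔ z = x ∨ z = y := fun z => by
    rw [← G.mem_neighborFinset, hN, Finset.mem_insert, Finset.mem_singleton]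
  refine ⟨x, y, hxy, (hnbr x).2 (Or.inl rfl), (hnbr y).2 (Or.inr rfl), ?_⟩
  have hy := dipath_through_other_neighbour horient hanti hcc hxy hnbr
  have hx := dipath_through_other_neighbour horient hanti hcc hxy.symm
    fun z => (hnbr z).trans or_comm
  rcases hy with ⟨hvy, hyx⟩ | ⟨hxy', hyv⟩ <;> rcases hx with ⟨hvx, hxy''⟩ | ⟨hyx', hxv⟩
  · exact absurd hxy'' (hanti _ _ hyx)
  · exact Or.inr ⟨hvy, hyx, hxv⟩
  · exact Or.inl ⟨hvx, hxy', hyv⟩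
  · exact absurd hyx' (hanti _ _ hxy')
end

section
/- Let G⃗ be an oriented graph with at least three vertices and let v be a vertex of degree 2 in the underlying graph of G⃗. If G⃗ is complete convex, then the oriented graph G⃗ − v obtained by deleting v (and its incident arcs) is complete convex. -/
/-- deleting a vertex of degree 2 (its neighbours in the
underlying graph being exactly the two distinct vertices `x`, `y`) from a
complete-convex oriented graph with at least three vertices leaves a
complete-convex oriented graph. -/
theorem delete_degree_two_complete_convex
    {V : Type} [Fintype V] (A : V → V → Prop)
    (hirr : Irreflexive A) (hanti : ∀ u v, A u v → ¬ A v u)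
    (hcard : 3 ≤ Fintype.card V)
    (v x y : V) (hxy : x ≠ y)
    (hdeg : ∀ z, (A v z ∨ A z v) ↔ (z = x ∨ z = y))
    (hcc : OrientCompleteConvex A) :
    OrientCompleteConvex (fun a b : {w : V // w ≠ v} => A a.1 b.1) := by
  intro u w huw
  refine Set.eq_univ_of_forall fun z => ?_
  rintro T ⟨hsub, hT⟩
  let T' : Set V := {p | (∃ h : p ≠ v, (⟨p, h⟩ : {w : V // w ≠ v}) ∈ T) ∨
    (p = v ∧ ∀ q : {w : V // w ≠ v}, (q.1 = x ∨ q.1 = y) → q ∈ T)}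
  have hconv : OrientConvex A T' := by
    rintro c a b ha hb ⟨hac, hcb, hAac, hAcb⟩
    by_cases hc : c = v
    · subst hc
      refine Or.inr ⟨rfl, fun q hq => ?_⟩
      rcases ha with ⟨ha, haT⟩ | ⟨ha, -⟩
      swap
      · exact absurd ha hac
      rcases hb with ⟨hb, hbT⟩ | ⟨hb, -⟩
      swap
      · exact absurd hb.symm hcb
      have hab : a ≠ b := by
        rintro rfl
        exact hanti _ _ hAac hAcb
      have hax := (hdeg a).1 (Or.inr hAac)
      have hbx := (hdeg b).1 (Or.inl hAcb)
      have hq' : q.1 = a ∨ q.1 = b := by grind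
      rcases hq' with h | h
      · rwa [show q = ⟨a, ha⟩ from Subtype.ext h]
      · rwa [show q = ⟨b, hb⟩ from Subtype.ext h]
    · refine Or.inl ⟨hc, ?_⟩
      rcases ha with ⟨ha, haT⟩ | ⟨rfl, hall⟩
      · rcases hb with ⟨hb, hbT⟩ | ⟨rfl, hall⟩
        · exact hT _ _ _ haT hbT
            ⟨fun h => hac (congrArg Subtype.val h), fun h => hcb (congrArg Subtype.val h),
              hAac, hAcb⟩
        · exact hall _ ((hdeg c).1 (Or.inr hAcb))
      · exact hall _ ((hdeg c).1 (Or.inl hAac))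
  have hsub' : ({u.1, w.1} : Set V) ⊆ T' := by
    rintro p (rfl | rfl)
    · exact Or.inl ⟨u.2, hsub (Or.inl rfl)⟩
    · exact Or.inl ⟨w.2, hsub (Or.inr rfl)⟩
  have hz : z.1 ∈ orientConvHull A {u.1, w.1} := by
    rw [hcc _ _ huw]
    trivial
  rcases hz T' ⟨hsub', hconv⟩ with ⟨_, h⟩ | ⟨h, -⟩
  · exact h
  · exact absurd h z.2
end

section
/- Let T be a connected graph of tree-width at most 2 with at least two vertices (equivalently, a connected spanning subgraph of a 2-tree). An orientation T⃗ of T is complete convex if and only if T is itself a 2-tree and every induced copy of K3 in T is oriented as a directed 3-cycle in T⃗. -/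
/-- The graph obtained from `G` by adding a new vertex adjacent to exactly the
two endpoints `x`, `y` of an existing edge. -/
def addApexVertex {V : Type} (G : SimpleGraph V) (x y : V) : SimpleGraph (Option V) :=
  SimpleGraph.fromRel (fun a b =>
    (∃ va vb, a = some va ∧ b = some vb ∧ G.Adj va vb) ∨
    (a = none ∧ (b = some x ∨ b = some y)))

/-- 2-trees: graphs obtained from `K2` by repeatedly adding a new vertex
adjacent to exactly the two endpoints of an existing edge (up to isomorphism). -/
inductive Is2Tree : {V : Type} → SimpleGraph V → Prop
  | base : Is2Tree (⊤ : SimpleGraph (Fin 2))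
  | extend {V : Type} (G : SimpleGraph V) (x y : V) (hxy : G.Adj x y) :
      Is2Tree G → Is2Tree (addApexVertex G x y)
  | iso {V W : Type} (G : SimpleGraph V) (H : SimpleGraph W) :
      Is2Tree G → G ≃g H → Is2Tree H

theorem orientCompleteConvex_iff {V : Type} {A : V → V → Prop} :
    OrientCompleteConvex A ↔
      ∀ S : Set V, OrientConvex A S → ∀ u v, A u v → u ∈ S → v ∈ S → ∀ z, z ∈ S := by
  constructor
  · intro h S hS u v huv hu hv z
    have hz : z ∈ orientConvHull A {u, v} := h u v huv ▸ Set.mem_univ z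
    exact hz S ⟨by rintro w (rfl | rfl) <;> assumption, hS⟩
  · intro h u v huv
    refine Set.eq_univ_of_forall fun z S hS => ?_
    exact h S hS.2 u v huv (hS.1 (by simp)) (hS.1 (by simp)) z

section addApexVertex

variable {V : Type} {G : SimpleGraph V} {x y : V}

@[simp]
theorem addApexVertex_adj_some_some {a b : V} :
    (addApexVertex G x y).Adj (some a) (some b) ↔ G.Adj a b := by
  simp only [addApexVertex, SimpleGraph.fromRel_adj]
  constructor
  · rintro ⟨-, h⟩
    simpa [G.adj_comm b a] using h
  · intro h
    simp [h, h.ne]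

@[simp]
theorem addApexVertex_adj_none_some {b : V} :
    (addApexVertex G x y).Adj none (some b) ↔ b = x ∨ b = y := by
  simp [addApexVertex]

@[simp]
theorem addApexVertex_adj_some_none {b : V} :
    (addApexVertex G x y).Adj (some b) none ↔ b = x ∨ b = y := by
  rw [SimpleGraph.adj_comm, addApexVertex_adj_none_some]

end addApexVertex

/-- In a 2-tree, a set containing both ends of an edge and closed under completing triangles
contains every vertex. -/
theorem Is2Tree.mem_of_triangle_closed {V : Type} {G : SimpleGraph V} (hG : Is2Tree G) :
    ∀ S : Set V, (∀ a b c, G.Adj a b → G.Adj b c → G.Adj a c → a ∈ S → b ∈ S → c ∈ S) →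
      ∀ u v, G.Adj u v → u ∈ S → v ∈ S → ∀ z, z ∈ S := by
  induction hG with
  | base =>
    intro S _ u v huv hu hv z
    have huv' : u ≠ v := huv.ne
    have : z = u ∨ z = v := by omega
    rcases this with rfl | rfl <;> assumption
  | @extend V G x y hxy _ ih =>
    intro S hS
    have old : ∀ u v, G.Adj u v → some u ∈ S → some v ∈ S → ∀ z, z ∈ S := by
      intro u v huv hu hv z
      have hall : ∀ w, some w ∈ S :=
        ih (some ⁻¹' S) (fun a b c hab hbc hac ha hb =>
          hS (some a) (some b) (some c) (by simpa) (by simpa) (by simpa) ha hb) u v huv hu hv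
      cases z with
      | some z => exact hall z
      | none =>
        exact hS (some x) (some y) none (by simpa) (by simp) (by simp) (hall x) (hall y)
    have new : ∀ v, (v = x ∨ v = y) → none ∈ S → some v ∈ S → ∀ z, z ∈ S := by
      rintro v (rfl | rfl) hn hv
      · exact old _ _ hxy hv
          (hS none (some v) (some y) (by simp) (by simpa) (by simp) hn hv)
      · exact old _ _ hxy
          (hS none (some v) (some x) (by simp) (by simpa using hxy.symm) (by simp) hn hv) hv
    rintro (_ | u) (_ | v) huv hu hv
    · exact absurd rfl huv.ne
    · exact new v (by simpa using huv) hu hv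
    · exact new u (by simpa using huv) hv hu
    · exact old u v (by simpa using huv) hu hv
  | iso G H _ e ih =>
    intro S hS u v huv hu hv z
    have := ih (e ⁻¹' S) (fun a b c hab hbc hac =>
      hS (e a) (e b) (e c) (e.map_adj_iff.2 hab) (e.map_adj_iff.2 hbc) (e.map_adj_iff.2 hac))
      (e.symm u) (e.symm v) (e.symm.map_adj_iff.2 huv) (by simpa) (by simpa) (e.symm z)
    simpa using this

/-- Complete convexity is inherited when deleting a vertex with at most two neighbours. -/
theorem OrientCompleteConvex.of_option {V : Type} {A : Option V → Option V → Prop} {x y : V}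
    (hx : ∀ v, A (some v) none ∨ A none (some v) → v = x ∨ v = y)
    (hanti : ∀ u v, A u v → ¬ A v u) (h : OrientCompleteConvex A) :
    OrientCompleteConvex fun u v => A (some u) (some v) := by
  rw [orientCompleteConvex_iff] at h ⊢
  intro S hS u v huv hu hv z
  by_cases hxy : x ∈ S ∧ y ∈ S
  · have hconv : OrientConvex A {w | ∀ a, w = some a → a ∈ S} := by
      rintro c p q hp hq ⟨hpc, hcq, h1, h2⟩ c' rfl
      have nbr : A (some c') none ∨ A none (some c') → c' ∈ S := by
        intro hc
        rcases hx c' hc with rfl | rfl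
        exacts [hxy.1, hxy.2]
      rcases p with _ | p
      · exact nbr (.inr h1)
      rcases q with _ | q
      · exact nbr (.inl h2)
      exact hS c' p q (hp p rfl) (hq q rfl) ⟨by simpa using hpc, by simpa using hcq, h1, h2⟩
    exact h _ hconv (some u) (some v) huv (by simpa) (by simpa) (some z) z rfl
  · have hconv : OrientConvex A (some '' S) := by
      rintro c _ _ ⟨p, hp, rfl⟩ ⟨q, hq, rfl⟩ ⟨hpc, hcq, h1, h2⟩
      rcases c with _ | c
      · rcases hx p (.inl h1) with rfl | rfl <;> rcases hx q (.inr h2) with rfl | rfl <;>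
          first | exact absurd h2 (hanti _ _ h1) | exact absurd (by constructor <;> assumption) hxy
      · exact ⟨c, hS c p q hp hq ⟨by simpa using hpc, by simpa using hcq, h1, h2⟩, rfl⟩
    simpa using h _ hconv (some u) (some v) huv (by simpa) (by simpa) (some z)

/-- In a complete convex oriented graph, every arc `uv` missing some vertex lies in a triangle
where its two ends are joined by a 2-dipath through the third vertex. -/
theorem OrientCompleteConvex.exists_centre {V : Type} {A : V → V → Prop}
    (h : OrientCompleteConvex A) (hanti : ∀ u v, A u v → ¬ A v u) {u v z : V} (huv : A u v)
    (hzu : z ≠ u) (hzv : z ≠ v) : ∃ w, (A v w ∧ A w u) ∨ (A u w ∧ A w v) := by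
  rw [orientCompleteConvex_iff] at h
  by_contra! hw
  have hconv : OrientConvex A {u, v} := by
    rintro c p q (rfl | rfl) (rfl | rfl) ⟨-, -, h1, h2⟩
    · exact absurd h2 (hanti _ _ h1)
    · exact absurd h2 ((hw c).2 h1)
    · exact absurd h2 ((hw c).1 h1)
    · exact absurd h2 (hanti _ _ h1)
  rcases h _ hconv u v huv (by simp) (by simp) z with hz | hz
  exacts [hzu hz, hzv hz]

/-- In a complete convex oriented graph, every vertex missed by some arc is the centre of a
2-dipath. -/
theorem OrientCompleteConvex.exists_dipath {V : Type} {A : V → V → Prop}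
    (h : OrientCompleteConvex A) {u v c : V} (huv : A u v) (hcu : c ≠ u) (hcv : c ≠ v) :
    ∃ p q, A p c ∧ A c q := by
  rw [orientCompleteConvex_iff] at h
  by_contra! hc
  refine h {c}ᶜ ?_ u v huv hcu.symm hcv.symm c rfl
  rintro d p q - - ⟨-, -, h1, h2⟩ rfl
  exact hc p q h1 h2

/-- A complete convex oriented spanning subgraph of a 2-tree is the whole 2-tree, and has no
transitive triangle. -/
theorem Is2Tree.of_orientCompleteConvex {V : Type} {G : SimpleGraph V} (hG : Is2Tree G) :
    ∀ A : V → V → Prop, (∀ u v, A u v → G.Adj u v) → (∀ u v, A u v → ¬ A v u) →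
      OrientCompleteConvex A → (∃ u v, A u v) →
      (∀ u v, G.Adj u v → A u v ∨ A v u) ∧ ∀ a b c, A a b → A b c → ¬ A a c := by
  induction hG with
  | base =>
    rintro A hA hanti - ⟨u, v, huv⟩
    constructor
    · intro a b hab
      have h1 : u ≠ v := (hA u v huv).ne
      have h2 : a ≠ b := hab.ne
      have : (u = a ∧ v = b) ∨ (u = b ∧ v = a) := by omega
      rcases this with ⟨rfl, rfl⟩ | ⟨rfl, rfl⟩
      exacts [.inl huv, .inr huv]
    · intro a b c hab hbc hac
      have h1 : a ≠ b := (hA _ _ hab).ne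
      have h2 : b ≠ c := (hA _ _ hbc).ne
      have h3 : a ≠ c := (hA _ _ hac).ne
      omega
  | @extend V G x y hxy _ ih =>
    intro A hA hanti hcc hne
    have hirr : ∀ u, ¬ A u u := fun u hu => hanti u u hu hu
    have hnbr : ∀ v, A (some v) none ∨ A none (some v) → v = x ∨ v = y := by
      rintro v (hv | hv)
      · simpa using hA _ _ hv
      · simpa using hA _ _ hv
    have hmiss : ∀ v, ∃ z : Option V, z ≠ none ∧ z ≠ some v := by
      intro v
      by_cases hv : x = v
      · exact ⟨some y, by simp, by simpa [← hv] using hxy.ne'⟩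
      · exact ⟨some x, by simp, by simpa using hv⟩
    have hold : ∃ u v, A (some u) (some v) := by
      obtain ⟨_ | u, _ | v, huv⟩ := hne
      · exact absurd huv (hirr _)
      · obtain ⟨z, hz1, hz2⟩ := hmiss v
        obtain ⟨_ | w, hw⟩ := hcc.exists_centre hanti huv hz1 hz2
        · grind
        · exact hw.elim (fun h => ⟨v, w, h.1⟩) (fun h => ⟨w, v, h.2⟩)
      · obtain ⟨z, hz1, hz2⟩ := hmiss u
        obtain ⟨_ | w, hw⟩ := hcc.exists_centre hanti huv hz2 hz1
        · grind
        · exact hw.elim (fun h => ⟨w, u, h.2⟩) (fun h => ⟨u, w, h.1⟩)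
      · exact ⟨u, v, huv⟩
    obtain ⟨hadj, htri⟩ := ih (fun u v => A (some u) (some v))
      (fun u v huv => by simpa using hA _ _ huv) (fun u v => hanti _ _)
      (hcc.of_option hnbr hanti) hold
    have hpq : ∃ p q, (p = x ∧ q = y ∨ p = y ∧ q = x) ∧ A (some p) none ∧ A none (some q) := by
      obtain ⟨u, v, huv⟩ := hold
      obtain ⟨_ | p, _ | q, hp, hq⟩ := hcc.exists_dipath (c := none) huv (by simp) (by simp)
      · exact absurd hp (hirr _)
      · exact absurd hp (hirr _)
      · exact absurd hq (hirr _)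
      · refine ⟨p, q, ?_, hp, hq⟩
        have := hanti _ _ hp
        rcases hnbr p (.inl hp) with rfl | rfl <;> rcases hnbr q (.inr hq) with rfl | rfl <;> grind
    obtain ⟨p, q, hpq, hp, hq⟩ := hpq
    have hGpq : G.Adj p q := by
      rcases hpq with ⟨rfl, rfl⟩ | ⟨rfl, rfl⟩
      exacts [hxy, hxy.symm]
    have hnbr' : ∀ v, A (some v) none ∨ A none (some v) → v = p ∨ v = q := by grind
    have hqp : A (some q) (some p) := by
      refine (hadj p q hGpq).resolve_left fun hA' => ?_
      obtain ⟨_ | w, hw⟩ := hcc.exists_centre hanti hp (z := some q)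
        (by simpa using hGpq.ne') (by simp)
      · grind
      · have := hnbr' w (by grind)
        grind
    constructor
    · rintro (_ | u) (_ | v) huv
      · exact absurd rfl huv.ne
      · have : v = x ∨ v = y := by simpa using huv
        grind
      · have : u = x ∨ u = y := by simpa using huv
        grind
      · exact hadj u v (by simpa using huv)
    · rintro (_ | a) (_ | b) (_ | c) hab hbc hac
      case some.some.some => exact htri a b c hab hbc hac
      all_goals grind
  | iso G H _ e ih =>
    intro A hA hanti hcc hne
    obtain ⟨hadj, htri⟩ := ih (fun u v => A (e u) (e v))
      (fun u v huv => e.map_adj_iff.1 (hA _ _ huv)) (fun u v => hanti _ _)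
      (by
        rw [orientCompleteConvex_iff] at hcc ⊢
        intro S hS u v huv hu hv z
        have hconv : OrientConvex A (e.symm ⁻¹' S) := by
          rintro c p q hp hq ⟨hpc, hcq, h1, h2⟩
          exact hS _ _ _ hp hq ⟨by simpa using hpc, by simpa using hcq, by simpa, by simpa⟩
        simpa using hcc _ hconv (e u) (e v) huv (by simpa) (by simpa) (e z))
      (by
        obtain ⟨u, v, huv⟩ := hne
        exact ⟨e.symm u, e.symm v, by simpa⟩)
    constructor
    · intro u v huv
      simpa using hadj (e.symm u) (e.symm v) (e.symm.map_adj_iff.2 huv)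
    · intro a b c hab hbc hac
      exact htri (e.symm a) (e.symm b) (e.symm c) (by simpa) (by simpa) (by simpa)

/-- for a connected graph `T` of tree-width at most 2 with at
least two vertices (a connected spanning subgraph of a 2-tree), an orientation
`A` of `T` is complete convex if and only if `T` is itself a 2-tree and every
induced copy of `K3` in `T` is oriented as a directed 3-cycle. -/
theorem treewidth_two_complete_convex_iff
    {V : Type} [Fintype V] (T : SimpleGraph V)
    (hconn : T.Connected) (hcard : 2 ≤ Fintype.card V)
    (htw : ∃ T' : SimpleGraph V, T ≤ T' ∧ Is2Tree T')
    (A : V → V → Prop)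
    (horient : ∀ u v, A u v ∨ A v u ↔ T.Adj u v)
    (hanti : ∀ u v, A u v → ¬ A v u) :
    OrientCompleteConvex A ↔
      (Is2Tree T ∧ ∀ x y z : V, T.Adj x y → T.Adj y z → T.Adj x z →
        ((A x y ∧ A y z ∧ A z x) ∨ (A y x ∧ A x z ∧ A z y))) := by
  constructor
  · intro hcc
    obtain ⟨T', hle, hT'⟩ := htw
    have : Nontrivial V := Fintype.one_lt_card_iff_nontrivial.1 hcard
    obtain ⟨v, hv⟩ := hconn.preconnected.exists_adj_of_nontrivial (Classical.arbitrary V)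
    obtain ⟨hadj, htri⟩ := hT'.of_orientCompleteConvex A
      (fun u v huv => hle ((horient u v).1 (.inl huv))) hanti hcc
      (((horient _ v).2 hv).elim (fun h => ⟨_, _, h⟩) fun h => ⟨_, _, h⟩)
    have hTT' : T = T' := le_antisymm hle fun u v huv => (horient u v).1 (hadj u v huv)
    refine ⟨hTT' ▸ hT', fun x y z hxy hyz hxz => ?_⟩
    rw [← horient] at hxy hyz hxz
    grind
  · rintro ⟨hT, htri⟩
    rw [orientCompleteConvex_iff]
    intro S hS u v huv hu hv
    refine hT.mem_of_triangle_closed S (fun a b c hab hbc hac ha hb => ?_) u v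
      ((horient u v).1 (.inl huv)) hu hv
    rcases htri a b c hab hbc hac with ⟨-, h1, h2⟩ | ⟨-, h1, h2⟩
    · exact hS c b a hb ha ⟨hbc.ne, hac.ne', h1, h2⟩
    · exact hS c a b ha hb ⟨hac.ne, hbc.ne', h1, h2⟩
end

section
/- Let G⃗ be a complete-convex oriented graph. If u and v are distinct non-adjacent vertices of G⃗ (neither uv nor vu is an arc) and u and v are the two ends of some 2-dipath in G⃗, then both of the oriented graphs G⃗ + uv and G⃗ + vu, obtained from G⃗ by adding the single arc uv (respectively vu), are complete convex. -/
theorem OrientConvex.mono {V : Type} {A B : V → V → Prop} (hAB : ∀ a b, A a b → B a b)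
    {S : Set V} (hS : OrientConvex B S) : OrientConvex A S :=
  fun v u w hu hw ⟨h₁, h₂, h₃, h₄⟩ => hS v u w hu hw ⟨h₁, h₂, hAB _ _ h₃, hAB _ _ h₄⟩

/-- In a complete-convex oriented graph, a convex set containing both ends of an arc is
the whole vertex set. -/
theorem OrientCompleteConvex.eq_univ {V : Type} {A : V → V → Prop}
    (hcc : OrientCompleteConvex A) {S : Set V} (hS : OrientConvex A S) {a b : V}
    (hab : A a b) (ha : a ∈ S) (hb : b ∈ S) : S = Set.univ :=
  Set.univ_subset_iff.mp (hcc a b hab ▸ Set.sInter_subset_of_mem ⟨Set.pair_subset ha hb, hS⟩)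

theorem OrientCompleteConvex.add_arc {V : Type} {A : V → V → Prop} (hirr : ∀ a, ¬ A a a)
    (hcc : OrientCompleteConvex A) (u v : V)
    (hdip : (∃ x, A u x ∧ A x v) ∨ (∃ x, A v x ∧ A x u)) :
    OrientCompleteConvex (fun a b => A a b ∨ (a = u ∧ b = v)) := by
  have hne : ∀ {a b}, A a b → a ≠ b := fun h e => hirr _ (e ▸ h)
  intro a b hab
  refine Set.sInter_eq_univ.mpr fun S ⟨hsub, hconv⟩ => ?_
  have hS : OrientConvex A S := hconv.mono fun _ _ => Or.inl
  have ha : a ∈ S := hsub (by simp)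
  have hb : b ∈ S := hsub (by simp)
  rcases hab with hab | ⟨rfl, rfl⟩
  · exact hcc.eq_univ hS hab ha hb
  · rcases hdip with ⟨x, h₁, h₂⟩ | ⟨x, h₁, h₂⟩
    · exact hcc.eq_univ hS h₁ ha (hS x a b ha hb ⟨hne h₁, hne h₂, h₁, h₂⟩)
    · exact hcc.eq_univ hS h₁ hb (hS x b a hb ha ⟨hne h₁, hne h₂, h₁, h₂⟩)

/-- if `u` and `v` are distinct non-adjacent vertices of a
complete-convex oriented graph and are the two ends of some 2-dipath, then
adding either of the arcs `uv` or `vu` yields a complete-convex oriented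
graph. -/
theorem add_arc_complete_convex
    {V : Type} [Fintype V] (A : V → V → Prop)
    (hirr : Irreflexive A) (hanti : ∀ u v, A u v → ¬ A v u)
    (hcc : OrientCompleteConvex A)
    (u v : V) (huv : u ≠ v) (hnadj₁ : ¬ A u v) (hnadj₂ : ¬ A v u)
    (hdip : (∃ x, A u x ∧ A x v) ∨ (∃ x, A v x ∧ A x u)) :
    OrientCompleteConvex (fun a b => A a b ∨ (a = u ∧ b = v)) ∧
    OrientCompleteConvex (fun a b => A a b ∨ (a = v ∧ b = u)) := by
  exact ⟨hcc.add_arc hirr u v hdip, hcc.add_arc hirr v u hdip.symm⟩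
end

section
/- Let G be a connected graph with n ≥ 3 vertices and at most 2n − 3 edges. Then for every edge-colouring c_G of G with colours red and blue, the 2-edge-coloured graph (G, c_G) is not complete convex; that is, G is not the underlying graph of any complete-convex 2-edge-coloured graph. -/
/-- The edges of `H` with both ends in `S`. -/
def edgesWithin {V : Type} (H : SimpleGraph V) (S : Set V) : Set (Sym2 V) :=
  {e ∈ H.edgeSet | ∀ z ∈ e, z ∈ S}

theorem ncard_edgesWithin_insert {V : Type} [Finite V] {H : SimpleGraph V} {S : Set V} {x y : V}
    (hx : x ∉ S) (hy : y ∈ S) (h : H.Adj x y) :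
    (edgesWithin H S).ncard + 1 ≤ (edgesWithin H (insert x S)).ncard := by
  have hnot : s(x, y) ∉ edgesWithin H S := fun he => hx (he.2 x (Sym2.mem_mk_left x y))
  rw [← Set.ncard_insert_of_notMem hnot]
  refine Set.ncard_le_ncard (Set.insert_subset ⟨h, ?_⟩ fun e he => ⟨he.1, fun z hz => ?_⟩)
  · intro z hz
    rcases Sym2.mem_iff.mp hz with rfl | rfl
    · exact Set.mem_insert z S
    · exact Set.mem_insert_of_mem x hy
  · exact Set.mem_insert_of_mem x (he.2 z hz)

theorem AltCentre.exists_adj {V : Type} {R B : SimpleGraph V} {v u w : V}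
    (h : AltCentre R B v u w) {S : Set V} (hu : u ∈ S) (hw : w ∈ S) :
    (∃ y ∈ S, R.Adj v y) ∧ ∃ y ∈ S, B.Adj v y := by
  rcases h.2.2 with ⟨h₁, h₂⟩ | ⟨h₁, h₂⟩
  · exact ⟨⟨u, hu, h₁.symm⟩, w, hw, h₂⟩
  · exact ⟨⟨w, hw, h₂⟩, u, hu, h₁.symm⟩

theorem TwoECCompleteConvex.symm {V : Type} {R B : SimpleGraph V}
    (h : TwoECCompleteConvex R B) : TwoECCompleteConvex B R := by
  have hconv : ∀ T : Set V, TwoECConvex R B T ↔ TwoECConvex B R T := fun T => by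
    simp only [TwoECConvex, AltCentre, or_comm]
  intro u v huv
  rw [← h u v (by rwa [sup_comm])]
  simp only [twoECConvHull, hconv]

/-- Growing the hull of a red edge one vertex at a time, each new vertex brings a new red edge and
a new blue edge. -/
theorem TwoECCompleteConvex.card_le {V : Type} [Finite V] {R B : SimpleGraph V}
    (h : TwoECCompleteConvex R B) {u v : V} (huv : R.Adj u v) :
    Nat.card V ≤ R.edgeSet.ncard + 1 ∧ Nat.card V ≤ B.edgeSet.ncard + 2 := by
  let P : Set V → Prop := fun S => {u, v} ⊆ S ∧
    S.ncard ≤ (edgesWithin R S).ncard + 1 ∧ S.ncard ≤ (edgesWithin B S).ncard + 2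
  have hP : P {u, v} := by
    have hpos : 0 < (edgesWithin R {u, v}).ncard :=
      (Set.ncard_pos).mpr ⟨s(u, v), huv, fun z hz => Sym2.mem_iff.mp hz⟩
    have := Set.ncard_pair huv.ne
    exact ⟨subset_rfl, by omega, by omega⟩
  obtain ⟨S, hS⟩ := (Set.toFinite {S | P S}).exists_maximal ⟨_, hP⟩
  obtain ⟨hsub, hR, hB⟩ := hS.prop
  have hconvex : TwoECConvex R B S := by
    intro x a b ha hb hx
    by_contra hxS
    obtain ⟨⟨y, hy, hxy⟩, z, hz, hxz⟩ := hx.exists_adj ha hb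
    have hRx := ncard_edgesWithin_insert hxS hy hxy
    have hBx := ncard_edgesWithin_insert hxS hz hxz
    have hcard := Set.ncard_insert_of_notMem hxS
    have hPx : P (insert x S) :=
      ⟨hsub.trans (Set.subset_insert x S), by omega, by omega⟩
    exact hxS (hS.le_of_ge hPx (Set.subset_insert x S) (Set.mem_insert x S))
  have hS_univ : S = Set.univ :=
    Set.univ_subset_iff.mp (h u v (Or.inl huv) ▸ Set.sInter_subset_of_mem ⟨hsub, hconvex⟩)
  rw [hS_univ, Set.ncard_univ] at hR hB
  simpa [edgesWithin] using And.intro hR hB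

theorem TwoECCompleteConvex.two_mul_card_le {V : Type} [Finite V] {R B : SimpleGraph V}
    (h : TwoECCompleteConvex R B) (hcard : 3 ≤ Nat.card V) {u v : V} (huv : R.Adj u v) :
    2 * Nat.card V ≤ R.edgeSet.ncard + B.edgeSet.ncard + 2 := by
  obtain ⟨hR, hB⟩ := h.card_le huv
  obtain ⟨e, he⟩ := (Set.ncard_pos).mp (show 0 < B.edgeSet.ncard by omega)
  induction e with
  | _ x y =>
    have := (h.symm.card_le (B.mem_edgeSet.mp he)).1
    omega

/-- a connected graph `G` with `n ≥ 3` vertices and at most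
`2n - 3` edges is not the underlying graph of any complete-convex
2-edge-coloured graph: no red/blue edge-colouring of `G` (a pair of
edge-disjoint graphs `R`, `B` with `R ⊔ B = G`) is complete convex. -/
theorem sparse_not_complete_convex
    {V : Type} [Fintype V] [DecidableEq V] (G : SimpleGraph V)
    [DecidableRel G.Adj]
    (hconn : G.Connected) (hcard : 3 ≤ Fintype.card V)
    (hedges : G.edgeFinset.card ≤ 2 * Fintype.card V - 3) :
    ∀ R B : SimpleGraph V, (∀ u v, ¬(R.Adj u v ∧ B.Adj u v)) → R ⊔ B = G →
      ¬ TwoECCompleteConvex R B := by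
  rintro R B hdisj rfl h
  have : Nontrivial V := Fintype.one_lt_card_iff_nontrivial.mp (by omega)
  obtain ⟨u⟩ := hconn.nonempty
  obtain ⟨v, huv⟩ := hconn.preconnected.exists_adj_of_nontrivial u
  have hlower : 2 * Nat.card V ≤ R.edgeSet.ncard + B.edgeSet.ncard + 2 := by
    have hcard' : 3 ≤ Nat.card V := by rwa [Nat.card_eq_fintype_card]
    rcases huv with huv | huv
    · exact h.two_mul_card_le hcard' huv
    · rw [add_comm R.edgeSet.ncard]
      exact h.symm.two_mul_card_le hcard' huv
  have hdisj' : Disjoint R.edgeSet B.edgeSet := by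
    rw [Set.disjoint_left]
    intro e
    induction e with
    | _ x y => exact fun hR hB => hdisj x y ⟨hR, hB⟩
  rw [← Set.ncard_union_eq hdisj', ← SimpleGraph.edgeSet_sup, ← SimpleGraph.coe_edgeFinset,
    Set.ncard_coe_finset, Nat.card_eq_fintype_card] at hlower
  omega
end

section
/- No connected graph of tree-width at most 2 with at least three vertices is the underlying graph of a complete-convex 2-edge-coloured graph; that is, if T is a connected spanning subgraph of a 2-tree with at least three vertices, then (T, c_T) is not complete convex for any red/blue edge-colouring c_T of T. -/
/-- The hull of `S` is contained in every convex set containing `S`. -/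
theorem twoECConvHull_subset {V : Type} {R B : SimpleGraph V} {S T : Set V}
    (hST : S ⊆ T) (hT : TwoECConvex R B T) : twoECConvHull R B S ⊆ T :=
  Set.sInter_subset_of_mem ⟨hST, hT⟩

/-- Every 2-tree has a vertex with at most two neighbours. -/
theorem Is2Tree.exists_adj_imp_eq_or_eq {V : Type} {G : SimpleGraph V} (h : Is2Tree G) :
    ∃ v x y, ∀ w, G.Adj v w → w = x ∨ w = y := by
  induction h with
  | base => exact ⟨0, 0, 1, fun w _ => by fin_cases w <;> simp⟩
  | extend G x y hxy hG ih =>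
    refine ⟨none, some x, some y, fun w hw => ?_⟩
    simpa [addApexVertex] using hw.2
  | iso G H hG e ih =>
    obtain ⟨v, x, y, h⟩ := ih
    refine ⟨e v, e x, e y, fun w hw => ?_⟩
    have := h (e.symm w) (by rw [← e.map_adj_iff]; simpa using hw)
    simpa [← e.symm.injective.eq_iff] using this

/-- In a complete-convex 2-edge-coloured graph with at least three vertices, the ends of
every edge are the ends of an alternating 2-path. -/
theorem TwoECCompleteConvex.exists_altCentre {V : Type} [Fintype V] {R B : SimpleGraph V}
    (hRB : ∀ u v, ¬(R.Adj u v ∧ B.Adj u v)) (hcard : 3 ≤ Fintype.card V)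
    (hcc : TwoECCompleteConvex R B) {u v : V} (huv : (R ⊔ B).Adj u v) :
    ∃ w, (R.Adj u w ∧ B.Adj v w) ∨ (B.Adj u w ∧ R.Adj v w) := by
  by_contra! hno
  have hconv : TwoECConvex R B {u, v} := by
    rintro w a b (rfl | rfl) (rfl | rfl) ⟨-, -, h⟩ <;>
      grind [SimpleGraph.adj_comm]
  have huniv := hcc u v huv ▸ twoECConvHull_subset subset_rfl hconv
  have hle := Set.ncard_le_ncard huniv
  rw [Set.ncard_univ, Nat.card_eq_fintype_card] at hle
  rw [Set.ncard_pair huv.ne] at hle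
  omega

/-- no connected graph of tree-width at most 2 (a connected
spanning subgraph of a 2-tree) with at least three vertices is the underlying
graph of a complete-convex 2-edge-coloured graph. -/
theorem treewidth_two_not_complete_convex_2ec
    {V : Type} [Fintype V] (T : SimpleGraph V)
    (hconn : T.Connected) (hcard : 3 ≤ Fintype.card V)
    (htw : ∃ T' : SimpleGraph V, T ≤ T' ∧ Is2Tree T') :
    ∀ R B : SimpleGraph V, (∀ u v, ¬(R.Adj u v ∧ B.Adj u v)) → R ⊔ B = T →
      ¬ TwoECCompleteConvex R B := by
  rintro R B hRB rfl hcc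
  obtain ⟨T', hTT', hT'⟩ := htw
  obtain ⟨v, x, y, hv⟩ := hT'.exists_adj_imp_eq_or_eq
  replace hv : ∀ w, R.Adj v w ∨ B.Adj v w → w = x ∨ w = y := fun w hw => hv w (hTT' hw)
  have : Nontrivial V := Fintype.one_lt_card_iff_nontrivial.mp (by omega)
  obtain ⟨a, ha⟩ := hconn.preconnected.exists_adj_of_nontrivial v
  obtain ⟨b, hb⟩ := hcc.exists_altCentre hRB hcard ha
  obtain ⟨c, hc⟩ := hcc.exists_altCentre hRB hcard (u := v) (v := b) (by
    rw [SimpleGraph.sup_adj]; tauto)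
  have hab : (R ⊔ B).Adj a b := by
    rw [SimpleGraph.sup_adj]; tauto
  have hconv : TwoECConvex R B {v}ᶜ := by
    rintro w p q - - ⟨-, -, h⟩ rfl
    rw [SimpleGraph.sup_adj] at ha
    have := R.irrefl (v := b)
    have := B.irrefl (v := b)
    grind [SimpleGraph.adj_comm]
  have hsub : ({a, b} : Set V) ⊆ {v}ᶜ := by
    rintro w (rfl | rfl) rfl
    · exact ha.ne rfl
    · rcases hb with h | h
      · exact h.1.ne rfl
      · exact h.1.ne rfl
  exact (hcc a b hab ▸ twoECConvHull_subset hsub hconv) (Set.mem_univ v) rfl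
end

section
/- Every 2-edge-coloured graph whose underlying graph is connected, has at least three vertices, and has tree-width at most 2 admits an improper homomorphism to a monochromatic reflexive copy of K2, i.e., to the reflexive 2-edge-coloured graph on two vertices joined by a single edge of one colour (with loops of both colours at each vertex). -/
/-- The edges of `addApexVertex G x y` are those of `G` and two more. -/
theorem edgeSet_addApexVertex_subset {V : Type} (G : SimpleGraph V) (x y : V) :
    (addApexVertex G x y).edgeSet ⊆
      Sym2.map some '' G.edgeSet ∪ {s(none, some x), s(none, some y)} := by
  intro e
  induction e with
  | _ a b =>
    rw [SimpleGraph.mem_edgeSet, addApexVertex, SimpleGraph.fromRel_adj]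
    rintro ⟨-, (⟨u, v, rfl, rfl, h⟩ | ⟨rfl, rfl | rfl⟩) |
      (⟨u, v, rfl, rfl, h⟩ | ⟨rfl, rfl | rfl⟩)⟩
    · exact Or.inl ⟨s(u, v), h, rfl⟩
    · simp
    · simp
    · exact Or.inl ⟨s(v, u), h.symm, rfl⟩
    · simp [Sym2.eq_swap]
    · simp [Sym2.eq_swap]

/-- A 2-tree on `n` vertices is finite and has at most `2 * n - 3` edges. -/
theorem Is2Tree.finite_and_ncard_edgeSet_add_three_le {V : Type} {G : SimpleGraph V}
    (h : Is2Tree G) : Finite V ∧ G.edgeSet.ncard + 3 ≤ 2 * Nat.card V := by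
  induction h with
  | base =>
    refine ⟨inferInstance, ?_⟩
    have h := SimpleGraph.card_edgeFinset_top_eq_card_choose_two (V := Fin 2)
    rw [← SimpleGraph.coe_edgeFinset, Set.ncard_coe_finset, h]
    simp
  | @extend V G x y _ _ ih =>
    obtain ⟨hfin, hle⟩ := ih
    refine ⟨inferInstance, ?_⟩
    have h₁ := Set.ncard_le_ncard (edgeSet_addApexVertex_subset G x y) (Set.toFinite _)
    have h₂ := Set.ncard_union_le (Sym2.map some '' G.edgeSet)
      {s(none, some x), s(none, some y)}
    have h₃ := Set.ncard_image_le (f := Sym2.map (some : V → Option V)) (Set.toFinite G.edgeSet)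
    have h₄ := Set.ncard_insert_le s(none, some x) {s(none, some y)}
    rw [Set.ncard_singleton] at h₄
    rw [Finite.card_option]
    omega
  | iso G H _ e ih =>
    obtain ⟨hfin, hle⟩ := ih
    refine ⟨Finite.of_equiv _ e.toEquiv, ?_⟩
    rwa [← Nat.card_coe_set_eq, ← Nat.card_congr e.mapEdgeSet, Nat.card_coe_set_eq,
      ← Nat.card_congr e.toEquiv]

/-- If the edges of `R` do not connect the at least three vertices of a connected graph
`R ⊔ B`, then some non-constant two-valued map collapses all edges of `R` and at least one
edge of `R ⊔ B`. -/
theorem exists_improper_of_not_connected {V : Type} [Fintype V] (R B : SimpleGraph V)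
    (hconn : (R ⊔ B).Connected) (hcard : 3 ≤ Fintype.card V) (hR : ¬ R.Connected) :
    ∃ φ : V → Bool, (∀ u v, R.Adj u v → φ u = φ v) ∧ ¬(∃ b, ∀ x, φ x = b) ∧
      (∃ u v, (R ⊔ B).Adj u v ∧ φ u = φ v) := by
  classical
  have hV := hconn.nonempty
  by_cases hedge : ∃ u v, R.Adj u v
  · obtain ⟨a, b, hab⟩ : ∃ a b, ¬ R.Reachable a b := by
      by_contra! h
      exact hR ⟨h⟩
    have hφ : ∀ u v, R.Adj u v → decide (R.Reachable a u) = decide (R.Reachable a v) :=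
      fun u v huv => decide_eq_decide.2
        ⟨fun h => h.trans huv.reachable, fun h => h.trans huv.symm.reachable⟩
    refine ⟨fun v => decide (R.Reachable a v), hφ, ?_, ?_⟩
    · rintro ⟨c, hc⟩
      have h := (hc a).trans (hc b).symm
      simp [hab] at h
    · obtain ⟨u, v, huv⟩ := hedge
      exact ⟨u, v, Or.inl huv, hφ u v huv⟩
  · push Not at hedge
    have : Nontrivial V := Fintype.one_lt_card_iff_nontrivial.1 (by omega)
    obtain ⟨u⟩ := hV
    obtain ⟨v, huv⟩ := hconn.preconnected.exists_adj_of_nontrivial u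
    obtain ⟨w, -, hw⟩ := Finset.exists_mem_notMem_of_card_lt_card
      (s := {u, v}) (t := Finset.univ) (by
        have := Finset.card_le_two (a := u) (b := v)
        rw [Finset.card_univ]
        omega)
    refine ⟨fun z => decide (z ∈ ({u, v} : Finset V)), fun a b h => (hedge a b h).elim, ?_,
      u, v, huv, by simp⟩
    rintro ⟨c, hc⟩
    have h := (hc u).trans (hc w).symm
    simp only [hw] at h
    simp at h

/-- The edge-disjoint union of two connected spanning graphs is not contained in a 2-tree. -/
theorem Is2Tree.not_connected_of_disjoint {V : Type} {R B T : SimpleGraph V} (hT : Is2Tree T)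
    (hle : R ⊔ B ≤ T) (hdisj : ∀ u v, ¬(R.Adj u v ∧ B.Adj u v)) (hR : R.Connected) :
    ¬ B.Connected := by
  intro hB
  obtain ⟨hfin, hcard⟩ := hT.finite_and_ncard_edgeSet_add_three_le
  have h₁ := hR.card_vert_le_card_edgeSet_add_one
  have h₂ := hB.card_vert_le_card_edgeSet_add_one
  rw [Nat.card_coe_set_eq] at h₁ h₂
  have hRB : Disjoint R.edgeSet B.edgeSet := by
    rw [Set.disjoint_left]
    intro e
    induction e with
    | _ u v => exact fun hr hb => hdisj u v ⟨hr, hb⟩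
  have h₃ := Set.ncard_union_eq hRB
  have h₄ := Set.ncard_le_ncard (SimpleGraph.edgeSet_mono hle) (Set.toFinite _)
  rw [SimpleGraph.edgeSet_sup] at h₄
  omega

/-- every 2-edge-coloured graph (red edges `R`, blue edges `B`)
whose underlying graph `R ⊔ B` is connected, has at least three vertices, and
has tree-width at most 2 admits an improper homomorphism to a monochromatic
reflexive `K2`.  The target is modelled on `Bool`: if the single edge of the
target is blue, then red edges of the target are loops only, so the
homomorphism condition is that red edges of the source are collapsed -- and
symmetrically if the single edge of the target is red; improper
means not constant yet collapsing some edge. -/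
theorem treewidth_two_improper_hom_to_mono_K2
    {V : Type} [Fintype V] (R B : SimpleGraph V)
    (hdisj : ∀ u v, ¬(R.Adj u v ∧ B.Adj u v))
    (hconn : (R ⊔ B).Connected) (hcard : 3 ≤ Fintype.card V)
    (htw : ∃ T' : SimpleGraph V, (R ⊔ B) ≤ T' ∧ Is2Tree T') :
    ∃ φ : V → Bool,
      ((∀ u v, R.Adj u v → φ u = φ v) ∨ (∀ u v, B.Adj u v → φ u = φ v)) ∧
      ¬(∃ b, ∀ x, φ x = b) ∧
      (∃ u v, (R ⊔ B).Adj u v ∧ φ u = φ v) := by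
  obtain ⟨T, hle, hT⟩ := htw
  by_cases hR : R.Connected
  · obtain ⟨φ, hφ, hne, u, v, huv, h⟩ := exists_improper_of_not_connected B R
      (sup_comm R B ▸ hconn) hcard (hT.not_connected_of_disjoint hle hdisj hR)
    exact ⟨φ, Or.inr hφ, hne, u, v, sup_comm R B ▸ huv, h⟩
  · obtain ⟨φ, hφ, h⟩ := exists_improper_of_not_connected R B hconn hcard hR
    exact ⟨φ, Or.inl hφ, h⟩
end

section
/- Let G⃗ be an irreflexive oriented graph (connected, with at least two vertices). If G⃗ is complete convex, then χ(G⃗) = χ_s(G⃗): the least k for which G⃗ admits a homomorphism to some tournament on k vertices equals the least k for which G⃗ admits a non-trivial homomorphism to some reflexive tournament on k vertices. -/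
/-- A tournament on `k` vertices: an irreflexive oriented graph in which every
pair of distinct vertices is joined by exactly one arc. -/
def IsTournament {k : ℕ} (B : Fin k → Fin k → Prop) : Prop :=
  Irreflexive B ∧ ∀ i j, i ≠ j → (B i j ↔ ¬ B j i)

/-- A reflexive tournament on `k` vertices: a loop at every vertex and exactly
one arc between any two distinct vertices. -/
def IsReflTournament {k : ℕ} (B : Fin k → Fin k → Prop) : Prop :=
  Reflexive B ∧ ∀ i j, i ≠ j → (B i j ↔ ¬ B j i)

/-- The (oriented) chromatic number of an oriented graph: the least `k` such
that it admits a homomorphism to some tournament on `k` vertices. -/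
noncomputable def orientChrom {V : Type} (A : V → V → Prop) : ℕ :=
  sInf {k : ℕ | ∃ B : Fin k → Fin k → Prop, IsTournament B ∧
    ∃ φ : V → Fin k, ∀ u v, A u v → B (φ u) (φ v)}

/-- The simple chromatic number of an oriented graph: the least `k` such that
it admits a non-trivial homomorphism to some reflexive tournament on `k`
vertices. -/
noncomputable def orientSimpleChrom {V : Type} (A : V → V → Prop) : ℕ :=
  sInf {k : ℕ | ∃ B : Fin k → Fin k → Prop, IsReflTournament B ∧
    ∃ φ : V → Fin k, (∀ u v, A u v → B (φ u) (φ v)) ∧ ¬∃ w, ∀ x, φ x = w}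

/-- The fibres of a homomorphism to a reflexive tournament are convex. -/
theorem orientConvex_fibre {V : Type} {A : V → V → Prop} {k : ℕ} {B : Fin k → Fin k → Prop}
    (hB : IsReflTournament B) {φ : V → Fin k} (hφ : ∀ u v, A u v → B (φ u) (φ v))
    (c : Fin k) : OrientConvex A {x | φ x = c} := by
  rintro v u w hu hw ⟨-, -, huv, hvw⟩
  by_contra hv
  have h₁ := hφ u v huv
  have h₂ := hφ v w hvw
  rw [Set.mem_ofPred_eq] at hu hw hv
  rw [hu] at h₁
  rw [hw] at h₂
  exact (hB.2 (φ v) c hv).1 h₂ h₁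

/-- On a complete convex oriented graph, a homomorphism to a reflexive tournament which
identifies the ends of some arc is trivial. -/
theorem OrientCompleteConvex.eq_of_arc {V : Type} {A : V → V → Prop}
    (hcc : OrientCompleteConvex A) {k : ℕ} {B : Fin k → Fin k → Prop}
    (hB : IsReflTournament B) {φ : V → Fin k} (hφ : ∀ u v, A u v → B (φ u) (φ v))
    {u v : V} (huv : A u v) (h : φ u = φ v) (x : V) : φ x = φ u := by
  have hx : x ∈ orientConvHull A {u, v} := hcc u v huv ▸ Set.mem_univ x
  refine hx {y | φ y = φ u} ⟨?_, orientConvex_fibre hB hφ _⟩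
  rintro y (rfl | rfl)
  · rfl
  · exact h.symm

/-- A connected oriented graph with at least two vertices has an arc. -/
theorem exists_arc_of_connected {V : Type} [Nontrivial V] {A : V → V → Prop}
    (hconn : (SimpleGraph.fromRel A).Connected) : ∃ u v, A u v := by
  obtain ⟨x, y, hxy⟩ := exists_pair_ne V
  obtain ⟨p⟩ := hconn.preconnected x y
  cases p with
  | nil => exact absurd rfl hxy
  | cons h _ =>
    rcases ((SimpleGraph.fromRel_adj A _ _).1 h).2 with h | h
    · exact ⟨_, _, h⟩
    · exact ⟨_, _, h⟩

/-- for a connected irreflexive oriented graph with at least two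
vertices that is complete convex, the chromatic number equals the simple
chromatic number. -/
theorem complete_convex_chrom_eq_simple_chrom
    {V : Type} [Fintype V] (A : V → V → Prop)
    (hirr : Irreflexive A) (hanti : ∀ u v, A u v → ¬ A v u)
    (hconn : (SimpleGraph.fromRel A).Connected)
    (hcard : 2 ≤ Fintype.card V)
    (hcc : OrientCompleteConvex A) :
    orientChrom A = orientSimpleChrom A := by
  have : Nontrivial V := Fintype.one_lt_card_iff_nontrivial.1 hcard
  unfold orientChrom orientSimpleChrom
  congr 1
  ext k
  constructor
  · rintro ⟨B, hB, φ, hφ⟩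
    refine ⟨fun i j => i = j ∨ B i j, ⟨fun i => Or.inl rfl, fun i j hij => ?_⟩, φ,
      fun u v h => Or.inr (hφ u v h), ?_⟩
    · simpa [hij, hij.symm] using hB.2 i j hij
    · rintro ⟨c, hc⟩
      obtain ⟨u, v, huv⟩ := exists_arc_of_connected hconn
      have h := hφ u v huv
      rw [hc u, hc v] at h
      exact hB.1 c h
  · rintro ⟨B, hB, φ, hφ, hne⟩
    refine ⟨fun i j => i ≠ j ∧ B i j, ⟨fun i h => h.1 rfl, fun i j hij => ?_⟩, φ,
      fun u v h => ⟨fun he => hne ⟨φ u, hcc.eq_of_arc hB hφ h he⟩, hφ u v h⟩⟩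
    simpa [hij, hij.symm] using hB.2 i j hij
end

section
/- Let W⃗ be the family of all orientations of irreflexive connected graphs with at least two vertices and maximum degree at most 2 (that is, orientations of paths and cycles). Then χ_s(W⃗) = 3: every member of W⃗ admits a non-trivial homomorphism to some reflexive tournament on 3 vertices, and some member of W⃗ (the directed 3-cycle) admits no non-trivial homomorphism to any reflexive tournament on 2 vertices. -/
/-- `A` is an orientation of the graph `G`: each edge of `G` receives exactly
one of its two possible directions. -/
def IsOrientationOf {V : Type} (A : V → V → Prop) (G : SimpleGraph V) : Prop :=
  (∀ u v, A u v ∨ A v u ↔ G.Adj u v) ∧ ∀ u v, A u v → ¬ A v u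

/-- The reflexive directed 3-cycle. -/
def reflThreeCycle (i j : Fin 3) : Prop := i = j ∨ j = i + 1

instance : DecidableRel reflThreeCycle := fun i j =>
  inferInstanceAs (Decidable (i = j ∨ j = i + 1))

theorem isReflTournament_reflThreeCycle : IsReflTournament reflThreeCycle :=
  ⟨fun _ => .inl rfl, by decide⟩

section

variable {V : Type} {A : V → V → Prop}

/-- Separating a sink from all other vertices is a homomorphism. -/
theorem exists_hom_reflThreeCycle_of_sink [Nontrivial V] {v : V} (hv : ∀ y, ¬ A v y) :
    ∃ φ : V → Fin 3, (∀ x y, A x y → reflThreeCycle (φ x) (φ y)) ∧ ¬∃ w, ∀ x, φ x = w := by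
  classical
  refine ⟨fun x => if x = v then 1 else 0, fun x y hxy => ?_, ?_⟩
  · have hx : x ≠ v := by
      rintro rfl
      exact hv y hxy
    by_cases hy : y = v <;> simp [hx, hy, reflThreeCycle]
  · rintro ⟨w, hw⟩
    obtain ⟨u, hu⟩ := exists_ne v
    have h := (hw u).trans (hw v).symm
    simp [hu] at h

/-- Separating a source from all other vertices is a homomorphism. -/
theorem exists_hom_reflThreeCycle_of_source [Nontrivial V] {v : V} (hv : ∀ x, ¬ A x v) :
    ∃ φ : V → Fin 3, (∀ x y, A x y → reflThreeCycle (φ x) (φ y)) ∧ ¬∃ w, ∀ x, φ x = w := by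
  classical
  refine ⟨fun x => if x = v then 0 else 1, fun x y hxy => ?_, ?_⟩
  · have hy : y ≠ v := by
      rintro rfl
      exact hv x hxy
    by_cases hx : x = v <;> simp [hx, hy, reflThreeCycle]
  · rintro ⟨w, hw⟩
    obtain ⟨u, hu⟩ := exists_ne v
    have h := (hw u).trans (hw v).symm
    simp [hu] at h

/-- An arc `v → b` that is the only arc out of `v` and the only arc into `b` can be stretched
around the reflexive directed 3-cycle, all other vertices being sent to the third vertex. -/
theorem exists_hom_reflThreeCycle_of_arc (hA : ∀ x y, A x y → ¬ A y x) {v b : V} (hvb : A v b)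
    (hout : ∀ y, A v y → y = b) (hin : ∀ x, A x b → x = v) :
    ∃ φ : V → Fin 3, (∀ x y, A x y → reflThreeCycle (φ x) (φ y)) ∧ ¬∃ w, ∀ x, φ x = w := by
  classical
  have hbv : b ≠ v := by
    rintro rfl
    exact hA b b hvb hvb
  refine ⟨fun x => if x = v then 0 else if x = b then 1 else 2, fun x y hxy => ?_, ?_⟩
  · by_cases hx : x = v
    · subst hx
      simp [hout y hxy, hbv, reflThreeCycle]
    · have hyb : y ≠ b := by
        rintro rfl
        exact hx (hin x hxy)
      by_cases hxb : x = b
      · subst hxb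
        have hyv : y ≠ v := by
          rintro rfl
          exact hA _ _ hvb hxy
        simp [hx, hyb, hyv, reflThreeCycle]
      · by_cases hy : y = v <;> simp [hx, hxb, hyb, hy, reflThreeCycle]
  · rintro ⟨w, hw⟩
    have h := (hw b).trans (hw v).symm
    simp [hbv] at h

end

/-- Every orientation of a graph with at least two vertices and maximum degree at most 2 has a
non-trivial homomorphism to the reflexive directed 3-cycle. -/
theorem IsOrientationOf.exists_hom_reflThreeCycle {V : Type} [Nontrivial V] {G : SimpleGraph V}
    {A : V → V → Prop} (hA : IsOrientationOf A G)
    (hdeg : ∀ v x y z : V, G.Adj v x → G.Adj v y → G.Adj v z → (x = y ∨ x = z ∨ y = z)) :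
    ∃ φ : V → Fin 3, (∀ x y, A x y → reflThreeCycle (φ x) (φ y)) ∧ ¬∃ w, ∀ x, φ x = w := by
  obtain ⟨hadj, hasymm⟩ := hA
  by_cases hsink : ∃ v, ∀ y, ¬ A v y
  · exact exists_hom_reflThreeCycle_of_sink hsink.choose_spec
  by_cases hsource : ∃ v, ∀ x, ¬ A x v
  · exact exists_hom_reflThreeCycle_of_source hsource.choose_spec
  push Not at hsink hsource
  obtain ⟨v⟩ : Nonempty V := inferInstance
  obtain ⟨b, hvb⟩ := hsink v
  obtain ⟨c, hbc⟩ := hsink b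
  obtain ⟨a, hav⟩ := hsource v
  have hfwd {x y : V} (h : A x y) : G.Adj x y := (hadj x y).1 (.inl h)
  have hbwd {x y : V} (h : A x y) : G.Adj y x := (hfwd h).symm
  refine exists_hom_reflThreeCycle_of_arc hasymm hvb (fun y hy => ?_) fun x hx => ?_
  · rcases hdeg v y b a (hfwd hy) (hfwd hvb) (hbwd hav) with h | rfl | rfl
    · exact h
    · exact absurd hav (hasymm _ _ hy)
    · exact absurd hav (hasymm _ _ hvb)
  · rcases hdeg b x v c (hbwd hx) (hbwd hvb) (hfwd hbc) with h | rfl | rfl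
    · exact h
    · exact absurd hbc (hasymm _ _ hx)
    · exact absurd hbc (hasymm _ _ hvb)

/-- The directed 3-cycle has only trivial homomorphisms to reflexive tournaments on 2 vertices. -/
theorem IsReflTournament.hom_zmod_three_trivial {B : Fin 2 → Fin 2 → Prop}
    (hB : IsReflTournament B) {φ : ZMod 3 → Fin 2}
    (hφ : ∀ u v : ZMod 3, v = u + 1 → B (φ u) (φ v)) : ∃ w, ∀ x, φ x = w := by
  have h01 := hφ 0 1 (by decide)
  have h12 := hφ 1 2 (by decide)
  have h20 := hφ 2 0 (by decide)
  have hB01 := hB.2 0 1 (by decide)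
  refine ⟨φ 0, ?_⟩
  have key : φ 1 = φ 0 ∧ φ 2 = φ 0 := by
    generalize φ 0 = p, φ 1 = q, φ 2 = r at *
    fin_cases p <;> fin_cases q <;> fin_cases r <;> simp_all
  intro x
  fin_cases x
  exacts [rfl, key.1, key.2]

/-- the family of orientations of connected graphs with at least
two vertices and maximum degree at most 2 has simple chromatic number 3:
every such orientation admits a non-trivial homomorphism to some reflexive
tournament on 3 vertices, while the directed 3-cycle (on `ZMod 3`, with arcs
`u → u + 1`) admits no non-trivial homomorphism to any reflexive tournament on
2 vertices. -/
theorem max_degree_two_simple_chrom_three :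
    (∀ (V : Type) [Fintype V], ∀ G : SimpleGraph V, G.Connected →
      2 ≤ Fintype.card V →
      (∀ v x y z : V, G.Adj v x → G.Adj v y → G.Adj v z →
        (x = y ∨ x = z ∨ y = z)) →
      ∀ A : V → V → Prop, IsOrientationOf A G →
        ∃ B : Fin 3 → Fin 3 → Prop, IsReflTournament B ∧
          ∃ φ : V → Fin 3, (∀ u v, A u v → B (φ u) (φ v)) ∧ ¬∃ w, ∀ x, φ x = w)
    ∧
    (∀ B : Fin 2 → Fin 2 → Prop, IsReflTournament B →
      ∀ φ : ZMod 3 → Fin 2,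
        (∀ u v : ZMod 3, v = u + 1 → B (φ u) (φ v)) →
        ∃ w, ∀ x, φ x = w) := by
  refine ⟨fun V _ G _ hcard hdeg A hA => ?_, fun B hB φ hφ => hB.hom_zmod_three_trivial hφ⟩
  have : Nontrivial V := Fintype.one_lt_card_iff_nontrivial.1 hcard
  exact ⟨reflThreeCycle, isReflTournament_reflThreeCycle, hA.exists_hom_reflThreeCycle hdeg⟩
end
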